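/- The Adversary has a winning strategy in the Online Bin Stretching game Game(3, 112, 82); consequently no online bin stretching algorithm on 3 bins has stretching factor smaller than 112/82 ≈ 1.3658. -/

import Mathlib

/-- `AddToBin St e b` increases the load of the `b`-th bin of `St` by `e`
(appending a new bin of load `e` if `b` is beyond the length of `St`). -/
def AddToBin : List ℕ → ℕ → ℕ → List ℕ
  | [], e, _ => [e]
  | x :: s, e, 0 => (x + e) :: s
  | x :: s, e, k + 1 => x :: AddToBin s e k

/-- The load of the most loaded bin. -/
def MaxBinValue (St : List ℕ) : ℕ := St.foldr max 0

/-- `Packable m g ℓ` : the items of `ℓ` can be packed into `m` bins,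
each of total size at most `g`. -/
def Packable (m g : ℕ) (ℓ : List ℕ) : Prop :=
  ∃ P : List (List ℕ), P.length = m ∧ (∀ B ∈ P, B.sum ≤ g) ∧ P.flatten.Perm ℓ

/-- `AdvWins m t g ℓ St` : the Adversary has a winning strategy in the Online Bin
Stretching game `Game(m,t,g)` starting from the previously sent items `ℓ` and the
current bin loads `St` — the property `LowerBoundBS(ℓ, St)`.  Either the Adversary
has already won (some bin has load at least `t`, and all items sent so far can be
packed into `m` bins of capacity `g`), or the Adversary can send some positive item
`e` such that whatever bin `b < m` the Algorithm packs it into, the Adversary still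
has a winning strategy. -/
inductive AdvWins (m t g : ℕ) : List ℕ → List ℕ → Prop
  | win (ℓ St : List ℕ) : t ≤ MaxBinValue St → Packable m g ℓ → AdvWins m t g ℓ St
  | step (ℓ St : List ℕ) (e : ℕ) : 0 < e →
      (∀ b, b < m → AdvWins m t g (e :: ℓ) (AddToBin St e b)) →
      AdvWins m t g ℓ St

theorem AddToBin.exists_perm {St St' : List ℕ} (h : St.Perm St') (e : ℕ) :
    ∀ b < St'.length, ∃ b' < St.length, (AddToBin St e b').Perm (AddToBin St' e b) := by
  induction h with
  | nil => simp
  | @cons x l l' h ih =>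
    rintro (_ | b) hb
    · exact ⟨0, by simp, by simpa [AddToBin] using h⟩
    · obtain ⟨b', hb', hp⟩ := ih b (by simpa using hb)
      exact ⟨b' + 1, by simpa using hb', by simpa [AddToBin] using hp⟩
  | swap x y l =>
    rintro (_ | _ | b) hb
    · exact ⟨1, by simp, by simpa [AddToBin] using List.Perm.swap ..⟩
    · exact ⟨0, by simp, by simpa [AddToBin] using List.Perm.swap ..⟩
    · exact ⟨b + 2, by simpa using hb, by simpa [AddToBin] using List.Perm.swap ..⟩
  | trans _ _ ih₁ ih₂ =>
    intro b hb
    obtain ⟨b₂, hb₂, hp₂⟩ := ih₂ b hb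
    obtain ⟨b₁, hb₁, hp₁⟩ := ih₁ b₂ hb₂
    exact ⟨b₁, hb₁, hp₁.trans hp₂⟩

theorem AddToBin.length_eq {St : List ℕ} {b : ℕ} (e : ℕ) (hb : b < St.length) :
    (AddToBin St e b).length = St.length := by
  induction St generalizing b with
  | nil => simp at hb
  | cons x l ih =>
    cases b with
    | zero => simp [AddToBin]
    | succ b => simpa [AddToBin] using ih (by simpa using hb)

theorem MaxBinValue.congr_perm {St St' : List ℕ} (h : St.Perm St') :
    MaxBinValue St = MaxBinValue St' :=
  h.foldr_eq (f := max) (lcomm := ⟨max_left_comm⟩) 0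

/-- The game does not distinguish the bins. -/
theorem AdvWins.congr_perm {m t g : ℕ} {ℓ St St' : List ℕ} (h : AdvWins m t g ℓ St)
    (hlen : St.length = m) (hp : St.Perm St') : AdvWins m t g ℓ St' := by
  induction h generalizing St' with
  | win ℓ St ht hpack => exact .win _ _ (MaxBinValue.congr_perm hp ▸ ht) hpack
  | step ℓ St e he _ ih =>
    refine .step _ _ e he fun b hb => ?_
    obtain ⟨b', hb', hp'⟩ := AddToBin.exists_perm hp e b (by rw [← hp.length_eq, hlen]; exact hb)
    exact ih b' (hlen ▸ hb') ((AddToBin.length_eq e hb').trans hlen) hp'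

/-- Backtracking search for a packing of a list of items into three bins of
capacities `x`, `y`, `z`. -/
def packs : List ℕ → ℕ → ℕ → ℕ → Bool
  | [], _, _, _ => true
  | e :: ℓ, x, y, z =>
    (Nat.ble e x && packs ℓ (x - e) y z) || (Nat.ble e y && packs ℓ x (y - e) z) ||
      (Nat.ble e z && packs ℓ x y (z - e))

theorem exists_packing_of_packs {ℓ : List ℕ} {x y z : ℕ} (h : packs ℓ x y z = true) :
    ∃ A B C : List ℕ, A.sum ≤ x ∧ B.sum ≤ y ∧ C.sum ≤ z ∧ (A ++ (B ++ C)).Perm ℓ := by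
  induction ℓ generalizing x y z with
  | nil => exact ⟨[], [], [], by simp⟩
  | cons e ℓ ih =>
    simp only [packs, Bool.or_eq_true, Bool.and_eq_true, Nat.ble_eq] at h
    rcases h with (⟨he, h⟩ | ⟨he, h⟩) | ⟨he, h⟩ <;> obtain ⟨A, B, C, hA, hB, hC, hp⟩ := ih h
    · exact ⟨e :: A, B, C, by simp; omega, hB, hC, hp.cons e⟩
    · refine ⟨A, e :: B, C, hA, by simp; omega, hC, ?_⟩
      exact List.perm_middle.trans (hp.cons e)
    · refine ⟨A, B, e :: C, hA, hB, by simp; omega, ?_⟩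
      rw [← List.append_assoc] at hp ⊢
      exact List.perm_middle.trans (hp.cons e)

theorem packable_of_packs {g : ℕ} {ℓ : List ℕ} (h : packs ℓ g g g = true) :
    Packable 3 g ℓ := by
  obtain ⟨A, B, C, hA, hB, hC, hp⟩ := exists_packing_of_packs h
  exact ⟨[A, B, C], rfl, by simp [hA, hB, hC], by simpa using hp⟩

theorem advWins_three_step {t g e a b c : ℕ} {ℓ : List ℕ} (he : 0 < e)
    (h₀ : AdvWins 3 t g (e :: ℓ) [a + e, b, c]) (h₁ : AdvWins 3 t g (e :: ℓ) [a, b + e, c])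
    (h₂ : AdvWins 3 t g (e :: ℓ) [a, b, c + e]) : AdvWins 3 t g ℓ [a, b, c] := by
  refine .step _ _ e he fun i hi => ?_
  interval_cases i <;> assumption

theorem advWins_three_of_le {t g a b c : ℕ} {ℓ : List ℕ} (h : t ≤ a ∨ t ≤ b ∨ t ≤ c)
    (hp : Packable 3 g ℓ) : AdvWins 3 t g ℓ [a, b, c] :=
  .win _ _ (by simp only [MaxBinValue, List.foldr]; omega) hp

/-- If a bin already overflows, the Adversary may still send further items of size `e`. -/
theorem advWins_three_of_overflow {t g e : ℕ} (he : 0 < e) (n : ℕ) {a b c : ℕ} {ℓ : List ℕ}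
    (h : t ≤ a ∨ t ≤ b ∨ t ≤ c) (hp : Packable 3 g (List.replicate n e ++ ℓ)) :
    AdvWins 3 t g ℓ [a, b, c] := by
  induction n generalizing a b c ℓ with
  | zero => exact advWins_three_of_le h (by simpa using hp)
  | succ n ih =>
    rw [List.replicate_succ', List.append_assoc] at hp
    exact advWins_three_step he (ih (by omega) hp) (ih (by omega) hp) (ih (by omega) hp)

/-- By the pigeonhole principle, sending sufficiently many items of size `e` makes
some bin reach load `t + 1`. -/
theorem advWins_three_of_replicate {t g e : ℕ} (he : 0 < e) (n : ℕ) {a b c : ℕ} {ℓ : List ℕ}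
    (h : (t - a) / e + (t - b) / e + (t - c) / e < n)
    (hp : Packable 3 g (List.replicate n e ++ ℓ)) : AdvWins 3 (t + 1) g ℓ [a, b, c] := by
  induction n generalizing a b c ℓ with
  | zero => exact absurd h (Nat.not_lt_zero _)
  | succ n ih =>
    rw [List.replicate_succ', List.append_assoc] at hp
    have hdiv : ∀ x, ¬ t + 1 ≤ x + e → (t - x) / e = (t - (x + e)) / e + 1 := fun x hx => by
      rw [← Nat.add_div_right _ he]
      congr 1
      omega
    refine advWins_three_step he ?_ ?_ ?_
    · by_cases ho : t + 1 ≤ a + e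
      · exact advWins_three_of_overflow he n (.inl ho) hp
      · exact ih (by have := hdiv a ho; omega) hp
    · by_cases ho : t + 1 ≤ b + e
      · exact advWins_three_of_overflow he n (.inr (.inl ho)) hp
      · exact ih (by have := hdiv b ho; omega) hp
    · by_cases ho : t + 1 ≤ c + e
      · exact advWins_three_of_overflow he n (.inr (.inr ho)) hp
      · exact ih (by have := hdiv c ho; omega) hp

/-- A strategy of the Adversary on three bins: `N e s₀ s₁ s₂` sends an item of size `e` and
continues with `sᵢ` if the item is packed into the `i`-th bin, `R e` keeps sending items of size
`e` until a bin overflows, and `W` stops. -/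
inductive Strategy
  | W : Strategy
  | R : ℕ → Strategy
  | N : ℕ → Strategy → Strategy → Strategy → Strategy

/-- `s.wins t g ℓ a b c` checks that the strategy `s` wins `Game(3, t + 1, g)` from the items `ℓ`
and the loads `a`, `b`, `c`. The reply that packs an item into a bin is skipped when an earlier bin
has the same load. -/
def Strategy.wins (t g : ℕ) : Strategy → List ℕ → ℕ → ℕ → ℕ → Bool
  | .W, ℓ, a, b, c => (Nat.blt t a || Nat.blt t b || Nat.blt t c) && packs ℓ g g g
  | .R e, ℓ, a, b, c =>
    Nat.blt 0 e &&
      packs (List.replicate ((t - a) / e + (t - b) / e + (t - c) / e + 1) e ++ ℓ) g g g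
  | .N e s₀ s₁ s₂, ℓ, a, b, c =>
    Nat.blt 0 e && s₀.wins t g (e :: ℓ) (a + e) b c &&
      (Nat.beq b a || s₁.wins t g (e :: ℓ) a (b + e) c) &&
      (Nat.beq c a || Nat.beq c b || s₂.wins t g (e :: ℓ) a b (c + e))

theorem Strategy.advWins_of_wins {t g : ℕ} (s : Strategy) {ℓ : List ℕ} {a b c : ℕ}
    (h : s.wins t g ℓ a b c = true) : AdvWins 3 (t + 1) g ℓ [a, b, c] := by
  induction s generalizing ℓ a b c with
  | W =>
    simp only [Strategy.wins, Bool.and_eq_true, Bool.or_eq_true, Nat.blt_eq] at h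
    exact advWins_three_of_le (by omega) (packable_of_packs h.2)
  | R e =>
    simp only [Strategy.wins, Bool.and_eq_true, Nat.blt_eq] at h
    exact advWins_three_of_replicate h.1 _ (Nat.lt_succ_self _) (packable_of_packs h.2)
  | N e s₀ s₁ s₂ ih₀ ih₁ ih₂ =>
    simp only [Strategy.wins, Bool.and_eq_true, Bool.or_eq_true, Nat.blt_eq, Nat.beq_eq] at h
    obtain ⟨⟨⟨he, h₀⟩, h₁⟩, h₂⟩ := h
    have w₀ := ih₀ h₀
    have w₁ : AdvWins 3 (t + 1) g (e :: ℓ) [a, b + e, c] := by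
      rcases h₁ with rfl | h₁
      · exact w₀.congr_perm rfl (.swap ..)
      · exact ih₁ h₁
    refine advWins_three_step he w₀ w₁ ?_
    rcases h₂ with (rfl | rfl) | h₂
    · refine w₀.congr_perm rfl ?_
      exact (List.perm_append_comm (l₁ := [c + e]) (l₂ := [b, c])).trans (.swap ..)
    · exact w₁.congr_perm rfl (.cons _ (.swap ..))
    · exact ih₂ h₂

open Strategy in
/-- A winning strategy for `Game(3, 112, 82)`. -/
noncomputable def strategy : Strategy :=
  N 2 (N 2 (N 9 (N 3 (N 2 (N 18 (N 34 (N 48 W (R 64) W) (R 82) W) (N 21 (N 17 (R 56) (R 82) (N 26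
  (N 47 W (R 49) (R 49)) (R 73) (R 73))) W (N 12 (N 12 (N 24 (R 47) (R 70) (R 70)) (R 82) (R 82))
  W (N 12 (R 82) W (N 24 (R 70) W (R 47))))) W) (N 14 (N 36 (N 46 W (R 66) (R 66)) (R 82) (R 82))
  (N 14 (N 15 (N 15 (N 54 W (R 58) (R 58)) (R 82) (N 24 (N 48 W (R 49) (R 49)) (R 73) (R 73))) (R
  82) (N 15 (N 24 (N 48 W (R 49) (R 49)) (R 73) (R 73)) (R 82) (R 82))) W (N 27 (N 25 (N 48 W (R
  50) (R 50)) (R 73) (R 73)) W (N 25 (R 73) W (R 48)))) (N 16 (N 29 (N 53 W (R 57) (R 57)) (R 82)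
  (R 82)) (N 25 (N 25 (N 48 W (R 50) (R 50)) (R 73) (R 73)) (N 25 (R 73) (N 48 (R 50) W (R 50)) (R
  73)) (N 27 (R 73) (R 73) (R 48))) (N 29 (R 82) (R 82) (N 53 (R 57) (R 57) W)))) W) (N 7 (N 17 (N
  32 (N 50 W (R 62) (R 62)) (R 82) (R 82)) (N 20 (N 17 (R 56) (R 82) (N 24 (R 48) (R 72) (R 72)))
  W (N 13 (N 12 (N 23 (R 46) (R 69) W) (R 80) W) W W)) (N 15 (N 27 (N 54 W (R 55) (R 55)) (R 82)
  (R 82)) (N 24 (N 24 (N 47 W (R 48) (R 48)) (R 71) (R 71)) (N 24 (R 71) (N 47 (R 48) W (R 48)) (R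
  71)) (N 24 (R 71) (R 71) (R 47))) (N 27 (R 82) (R 82) (N 54 (R 55) (R 55) W)))) (N 3 (N 5 (N 10
  (N 31 (N 51 W (R 61) (R 61)) (R 82) (R 82)) (N 21 (N 16 (R 56) (R 82) (N 24 (R 48) (R 72) (R
  72))) (N 16 (R 82) (R 56) (N 24 (R 72) (R 48) (R 72))) (N 23 (N 23 (R 46) (R 69) (R 68)) (N 23
  (R 69) (R 46) W) W)) (N 26 (N 26 (R 51) (R 76) W) (N 26 (R 76) (R 51) (R 76)) W)) (N 15 (N 15 (N
  15 (R 56) (R 82) (N 24 (N 48 W (R 49) W) (R 73) W)) (R 82) (N 15 (N 24 (N 48 W (R 49) W) (R 73)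
  W) (R 82) W)) (N 16 (R 82) (N 16 (R 82) (R 56) (N 24 (R 72) (R 48) W)) (N 16 (R 82) (N 24 (R 72)
  (R 48) W) W)) (N 30 (N 24 (N 48 W (R 49) W) (R 73) W) (N 24 (R 72) (N 48 (R 49) W (R 49)) (R
  73)) W)) (N 27 (N 27 (N 54 W (N 55 W W (R 52)) (R 53)) (R 80) (R 80)) (N 27 (R 80) (N 54 (N 55 W
  W (R 52)) W (R 53)) (R 80)) (N 28 (R 80) (R 80) (R 53)))) (N 18 (N 30 (N 52 W (R 59) (R 60)) (R
  82) (R 82)) W (N 28 (N 25 (N 49 W (R 50) (R 50)) (R 74) (R 74)) W (N 25 (R 74) W (N 49 (R 50) W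
  W)))) (N 28 (N 27 (N 54 W (R 55) (R 55)) (R 82) (R 82)) (N 27 (R 82) (N 54 (R 55) W (R 55)) (R
  82)) (N 28 (R 82) (R 82) (R 54)))) (N 28 (N 27 (N 54 W (R 55) (R 55)) (R 82) (R 82)) (N 29 (R
  82) (R 53) (R 82)) (N 27 (R 82) (R 82) (N 54 (R 55) (R 55) W)))) W) (N 5 (N 21 (N 31 (N 51 W (R
  61) (R 61)) (R 82) (R 82)) W (N 26 (N 26 (N 51 W (R 52) (R 52)) (R 77) (R 77)) W (N 26 (R 77) W
  (N 51 (R 52) W W)))) (N 1 (N 6 (N 1 (N 18 (N 30 (N 52 W (R 60) (R 60)) (R 82) (R 82)) (N 30 (R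
  82) (N 52 (R 60) W (R 60)) (R 82)) (N 27 (N 28 (R 49) (R 73) (R 73)) (N 25 (R 75) (R 50) (R 74))
  (N 25 (R 75) (R 74) (R 50)))) (N 5 (N 15 (N 15 (N 15 (R 56) (R 82) (N 24 (N 48 W (R 49) W) (R
  73) W)) (R 82) (N 15 (N 24 (N 48 W (R 49) W) (R 73) W) (R 82) W)) (N 16 (R 82) (N 16 (R 82) (R
  56) (N 24 (R 72) (R 48) W)) (N 16 (R 82) (N 24 (R 72) (R 48) W) W)) (N 30 (N 24 (N 48 W (R 49)
  W) (R 73) W) (N 24 (R 73) (N 48 (R 49) W (R 49)) (R 73)) W)) (N 11 (N 20 (N 16 (R 56) (R 82) (N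
  24 (R 48) (R 71) (R 72))) (N 16 (R 82) (R 56) (N 24 (R 72) (R 48) (R 72))) (N 23 (N 23 (R 46) (R
  69) W) (N 23 (R 69) (R 46) (R 69)) W)) (N 31 (R 82) (N 51 (R 60) W (R 61)) (R 82)) (N 27 (N 25
  (N 50 W (R 51) (R 51)) (R 76) (R 76)) (N 25 (R 76) (N 50 (R 51) W W) W) W)) (N 27 (N 26 (R 54)
  (R 81) (R 81)) (N 26 (R 81) (R 54) (R 81)) (N 28 (R 80) (R 80) (R 53)))) (N 6 (N 16 (N 29 (N 53
  W (R 58) (R 58)) (R 82) (R 82)) (N 29 (R 82) (N 53 (R 58) W (R 58)) (R 82)) (N 26 (N 25 (R 49)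
  (R 73) (R 72)) (N 28 (R 72) (R 48) W) W)) (N 10 (N 20 (N 17 (N 55 W (R 56) (R 56)) (R 82) (N 25
  (R 47) (R 71) (R 71))) (N 16 (R 82) (R 56) (N 24 (R 72) (R 48) (R 72))) (N 23 (N 23 (R 46) (R
  69) (R 68)) (N 23 (R 69) (R 46) W) W)) (N 32 (R 82) (N 50 (R 60) W (R 61)) (R 82)) (N 27 (N 25
  (N 50 W (R 51) (R 51)) (R 76) (R 76)) (N 25 (R 76) (N 50 (R 51) W W) W) W)) (N 30 (N 26 (N 52 W
  (R 53) (R 53)) (R 78) (R 79)) (N 26 (R 78) (N 52 (R 53) W (R 53)) (R 79)) (N 31 (R 76) (R 76) (R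
  51))))) (N 15 (N 21 (N 17 (R 56) (R 82) (N 24 (R 48) (R 71) (R 71))) W (N 23 (N 23 (R 46) (R 69)
  (R 69)) W (N 23 (R 69) W (R 46)))) (N 32 (R 82) (N 50 (R 62) W (R 62)) (R 82)) (N 15 (N 18 (N 25
  (R 49) (R 74) (R 74)) W (N 12 (R 80) W (N 23 (R 69) W (R 46)))) (N 28 (R 81) (R 54) (R 81)) (N
  14 (N 13 (R 82) (R 82) (N 23 (R 70) (R 70) (R 47))) (R 82) (N 15 (N 24 (R 68) W (R 46)) (R 80)
  (N 53 (R 54) (R 54) W))))) (N 32 (N 26 (N 50 W (R 56) (R 56)) (R 81) (R 81)) (N 25 (R 82) (N 50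
  (R 57) W (R 57)) (R 82)) (N 25 (R 82) (R 82) (N 50 (R 57) (R 57) W)))) (N 4 (N 4 (N 19 (N 15 (N
  15 (R 56) (R 82) (N 24 (N 48 W (R 49) W) (R 73) W)) (R 82) (N 15 (N 24 (N 48 W (R 49) W) (R 73)
  W) (R 82) W)) (N 18 (R 82) (R 60) (N 26 (R 78) (R 52) (R 78))) (N 25 (N 25 (R 50) (R 75) (R 75))
  (N 25 (R 75) (R 50) (R 74)) (N 25 (R 75) (R 74) (R 50)))) (N 11 (N 21 (N 19 (R 56) (R 82) (N 24
  (R 48) (R 72) W)) W (N 24 (N 23 (N 46 W (R 47) (R 47)) (R 70) (R 70)) W (N 23 (R 70) W (N 46 (R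
  47) W W)))) (N 33 (R 82) (N 49 (R 63) W (R 63)) (R 82)) (N 26 (N 26 (R 52) (R 78) (R 78)) (N 26
  (R 78) (R 52) (R 78)) (N 26 (R 78) (R 78) (R 52)))) (N 29 (N 27 (N 53 W (R 55) (R 55)) (R 81) (R
  81)) (N 27 (R 81) (N 53 (R 55) W (R 55)) (R 81)) (N 30 (R 79) (R 79) (R 52)))) (N 16 (N 20 (N 18
  (R 56) (R 82) (N 24 (R 48) (R 72) (R 72))) (N 16 (R 82) (R 57) (N 25 (R 73) (R 48) (R 73))) (N
  12 (N 12 (N 23 (N 46 W (R 47) (R 47)) (R 70) (R 70)) (R 81) (R 81)) (N 12 (R 81) (N 25 (R 69) (R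
  46) W) W) W)) (N 32 (R 82) (N 50 (R 62) W (R 62)) (R 82)) (N 14 (N 24 (N 25 (R 48) (R 71) (R
  71)) (N 25 (R 71) (R 48) (R 71)) (N 24 (R 72) (R 72) (R 48))) (N 28 (R 82) (R 54) (R 82)) (N 28
  (R 82) (R 82) (R 54)))) (N 30 (N 26 (N 52 W (R 56) (R 56)) (R 82) (R 82)) (N 26 (R 82) (N 52 (R
  56) W W) W) W)) (N 6 (N 6 (N 17 (N 29 (N 53 W (R 58) (R 58)) (R 82) (R 82)) (N 29 (R 82) (N 53
  (R 58) W (R 58)) (R 82)) (N 26 (N 25 (R 49) (R 73) (R 73)) (N 28 (R 72) (R 48) (R 72)) (N 25 (R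
  73) (R 73) (R 49)))) (N 10 (N 21 (N 17 (N 55 W (R 56) (R 56)) (R 82) (N 25 (R 47) (R 71) (R
  71))) W (N 23 (N 23 (R 46) (R 69) (R 69)) W (N 23 (R 69) W (R 46)))) (N 32 (R 82) (N 50 (R 61) W
  (R 61)) (R 82)) (N 26 (N 26 (R 51) (R 76) (R 76)) (N 26 (R 76) (R 51) (R 76)) (N 26 (R 76) (R
  76) (R 51)))) (N 30 (N 26 (N 52 W (R 53) (R 53)) (R 79) (R 79)) (N 26 (R 79) (N 52 (R 53) W (R
  53)) (R 79)) (N 31 (R 77) (R 77) (R 51)))) (N 16 (N 20 (N 17 (R 56) (R 82) (N 24 (R 48) (R 72)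
  (R 72))) W (N 23 (N 23 (R 46) (R 69) (R 69)) W (N 23 (R 69) W (R 46)))) (N 32 (R 82) (N 50 (R
  61) W (R 61)) (R 82)) (N 14 (N 24 (N 23 (R 48) (R 70) (R 72)) (N 23 (R 71) (R 48) (R 72)) (N 25
  (R 71) (R 71) (R 47))) (N 28 (R 81) (R 54) (R 81)) (N 28 (R 81) (R 81) (R 54)))) (N 30 (N 29 (N
  52 W (R 53) (R 53)) (R 80) (R 80)) (N 26 (R 82) (N 52 (R 56) W (R 56)) (R 82)) (N 26 (R 82) (R
  82) (N 52 (R 56) (R 56) W))))) (N 30 (N 27 (N 52 W (R 55) (R 55)) (R 82) (R 82)) (N 26 (R 82) (N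
  52 (R 56) W (R 56)) (R 82)) (N 26 (R 82) (R 82) (N 52 (R 56) (R 56) W)))) W) (N 1 (N 2 (N 6 (N 2
  (N 3 (N 14 (N 36 (N 46 W (R 66) (R 66)) (R 82) (R 82)) (N 14 (N 15 (N 15 (N 54 W (R 57) (R 58))
  (R 82) (N 24 (N 48 W (R 49) (R 49)) (R 72) (R 73))) (R 82) (N 15 (N 24 (N 48 W (R 49) (R 49)) (R
  72) (R 73)) (R 82) (R 82))) W (N 28 (N 25 (R 49) (R 72) (R 73)) W (N 26 (R 72) W (R 48)))) (N 17
  (N 29 (N 53 W (R 57) (R 57)) (R 82) (R 82)) (N 25 (N 25 (R 49) (R 72) (R 73)) (N 25 (R 72) (R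
  49) (R 73)) (N 26 (R 73) (R 73) (R 48))) (N 29 (R 82) (R 82) (N 53 (R 57) (R 57) W)))) (N 7 (N
  15 (N 32 (N 50 W (R 62) (R 62)) (R 82) (R 82)) (N 21 (N 17 (R 56) (R 82) (N 24 (R 48) (R 72) (R
  72))) W (N 23 (N 23 (R 46) (R 69) (R 69)) W (N 23 (R 69) W (R 46)))) (N 15 (N 28 (R 54) (R 81)
  (R 81)) (N 18 (N 25 (R 49) (R 74) (R 74)) W (N 12 (R 80) W (N 23 (R 69) W (R 46)))) (N 14 (R 82)
  (N 13 (R 82) (R 82) (N 23 (R 70) (R 70) (R 47))) (N 15 (R 80) (N 24 (R 68) W (R 46)) (N 53 (R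
  54) (R 54) W))))) (N 19 (N 30 (N 52 W (R 60) (R 60)) (R 82) (R 82)) (N 30 (R 82) (N 52 (R 60) W
  (R 60)) (R 82)) (N 27 (N 25 (R 50) (R 75) (R 75)) (N 25 (R 75) (R 50) (R 75)) (N 25 (R 75) (R
  75) (R 50)))) (N 32 (N 25 (N 50 W (R 57) (R 57)) (R 82) (R 82)) (N 27 (R 80) (N 50 (R 55) W (R
  55)) (R 80)) (N 25 (R 82) (R 82) (N 50 (R 57) (R 57) W)))) (N 2 (N 16 (N 36 (N 46 W (R 64) (R
  64)) (R 82) (R 82)) (N 15 (N 27 (R 55) (R 82) (R 82)) (N 27 (R 82) (R 55) (R 82)) (N 25 (N 26 (R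
  47) (R 72) W) (N 24 (R 73) (N 48 (R 49) W (R 49)) (R 73)) W)) (N 15 (N 28 (N 54 W (R 56) (R 56))
  (R 82) (R 82)) (N 25 (N 26 (R 48) (R 72) (R 72)) (N 24 (R 73) (N 48 (R 49) W (R 49)) (R 73)) (N
  24 (R 73) (R 73) (N 48 (R 49) (R 49) W))) (N 28 (R 82) (R 82) (N 54 (R 56) (R 56) W)))) (N 28 (N
  27 (N 54 W (R 55) (R 55)) (R 82) (R 82)) (N 27 (R 82) (N 54 (R 55) W (R 55)) (R 82)) (N 28 (R
  82) (R 82) (R 54))) (N 7 (N 15 (N 33 (N 49 W (R 61) (R 61)) (R 82) (R 82)) (N 13 (N 28 (R 54) (R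
  81) (R 81)) (N 15 (R 82) (N 15 (R 80) (N 53 (R 54) W (R 54)) (N 23 (R 69) (R 46) W)) (N 12 (R
  82) (N 24 (R 70) (R 46) W) W)) (N 24 (N 23 (R 48) (R 72) (R 71)) (N 25 (R 71) (R 47) (R 71)) (N
  23 (R 71) (R 72) (R 48)))) (N 20 (N 16 (R 56) (N 24 (R 48) (R 72) (R 72)) (R 82)) (N 23 (N 23 (R
  46) (R 69) (R 69)) (N 23 (R 69) (R 46) W) W) W)) (N 30 (N 27 (N 52 W (R 55) (R 55)) (R 80) (R
  80)) (N 27 (R 80) (N 52 (R 55) W (R 55)) (R 80)) (N 30 (R 79) (R 79) (R 52))) (N 19 (N 31 (N 51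
  W (R 59) (R 59)) (R 82) (R 82)) (N 25 (N 25 (R 50) (R 75) (R 75)) (N 25 (R 75) (R 50) (R 75)) (N
  25 (R 75) (R 75) (R 50))) (N 31 (R 82) (R 82) (N 51 (R 59) (R 59) W)))))) (N 9 (N 17 (N 31 (N 51
  W (R 61) (R 61)) (R 82) (R 82)) (N 20 (N 17 (R 56) (R 82) (N 24 (R 48) (R 72) (R 72))) (N 17 (R
  82) (R 56) (N 24 (R 72) (R 48) (R 72))) (N 12 (N 12 (N 23 (R 46) (R 68) (R 69)) (R 80) (R 80))
  (N 12 (R 80) (N 23 (R 69) (R 46) W) W) W)) (N 14 (N 28 (R 54) (R 81) (R 81)) (N 24 (N 23 (R 48)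
  (R 72) (R 72)) (N 23 (R 72) (R 48) (R 72)) (N 25 (R 71) (R 71) (R 47))) (N 28 (R 81) (R 81) (R
  54)))) (N 19 (N 30 (N 52 W (R 60) (R 60)) (R 82) (R 82)) (N 30 (R 82) (N 52 (R 60) W (R 60)) (R
  82)) (N 26 (N 26 (R 50) (R 75) (R 75)) (N 25 (R 76) (N 50 (R 51) W (R 51)) (R 75)) (N 25 (R 76)
  (R 75) (N 50 (R 51) (R 51) W)))) (N 30 (N 26 (N 52 W (R 56) (R 56)) (R 82) (R 82)) (N 30 (R 80)
  (R 52) (R 80)) (N 26 (R 82) (R 82) (N 52 (R 56) (R 56) W)))) (N 9 (N 18 (N 33 (N 49 W (R 61) W)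
  (R 82) W) (N 10 (N 28 (N 54 W (R 56) (R 56)) (R 82) (R 82)) W (N 18 (N 26 (R 50) (R 74) (R 74))
  W (N 12 (R 82) W (N 24 (R 70) W (R 46))))) W) (N 19 (N 32 (N 50 W (R 60) (R 60)) (R 82) (R 82))
  W (N 26 (N 25 (N 50 W (R 51) (R 51)) (R 76) (R 75)) W (N 25 (R 76) W (N 50 (R 51) W W)))) W)) (N
  7 (N 3 (N 4 (N 11 (N 33 (N 49 W (R 63) (R 63)) (R 82) (R 82)) (N 21 (N 19 (R 56) (R 82) (N 24 (R
  48) (R 72) W)) W (N 24 (N 23 (N 46 W (R 47) (R 47)) (R 70) (R 69)) W (N 23 (R 70) W (N 46 (R 47)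
  W W)))) (N 26 (N 26 (R 52) (R 78) (R 78)) (N 26 (R 78) (R 52) (R 78)) (N 26 (R 78) (R 78) (R
  52)))) (N 19 (N 18 (R 60) (R 82) (N 26 (R 52) (R 78) (R 78))) (N 15 (R 82) (N 15 (R 82) (R 56)
  (N 24 (R 73) (N 48 (R 49) W W) W)) (N 15 (R 82) (N 24 (R 73) (N 48 (R 49) W W) W) W)) (N 25 (N
  25 (R 50) (R 75) (R 75)) (N 25 (R 75) (R 50) (R 75)) (N 25 (R 75) (R 75) (R 50)))) (N 29 (N 27
  (N 53 W (R 55) (R 55)) (R 81) (R 81)) (N 27 (R 81) (N 53 (R 55) W (R 55)) (R 81)) (N 30 (R 79)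
  (R 79) (R 52)))) (N 20 (N 30 (N 52 W (R 60) (R 60)) (R 82) (R 82)) (N 30 (R 82) (N 52 (R 60) W
  (R 60)) (R 82)) (N 26 (N 25 (N 50 W (R 51) (R 51)) (R 76) (R 76)) (N 27 (R 75) (R 50) (R 75)) (N
  25 (R 76) (R 76) (N 50 (R 51) (R 51) W)))) (N 28 (N 27 (N 54 W (R 55) (R 55)) (R 82) (R 82)) (N
  27 (R 82) (N 54 (R 55) W (R 55)) (R 82)) (N 30 (R 82) (R 82) (R 52)))) (N 5 (N 6 (N 15 (N 15 (N
  15 (R 56) (R 82) (N 24 (N 48 W (R 49) W) (R 73) W)) (R 82) (N 15 (N 24 (N 48 W (R 49) W) (R 73)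
  W) (R 82) W)) (N 16 (R 82) (N 16 (R 82) (R 56) (N 24 (R 72) (R 48) W)) (N 16 (R 82) (N 24 (R 72)
  (R 48) W) W)) (N 30 (N 24 (N 48 W (R 49) W) (R 73) W) (N 24 (R 73) (N 48 (R 49) W (R 49)) (R
  73)) W)) (N 10 (N 21 (N 16 (R 56) (R 82) (N 24 (R 48) (R 71) (R 72))) (N 16 (R 82) (R 56) (N 24
  (R 71) (R 48) (R 72))) (N 23 (N 23 (R 46) (R 69) W) (N 23 (R 69) (R 46) (R 69)) W)) (N 31 (R 82)
  (N 51 (R 61) W (R 61)) (R 82)) (N 26 (N 26 (R 51) (R 76) (R 76)) (N 26 (R 76) (R 51) W) W)) (N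
  29 (N 27 (R 53) (R 79) (R 79)) (N 27 (R 79) (R 53) (R 79)) (N 31 (R 77) (R 77) (R 51)))) (N 15
  (N 21 (N 17 (R 56) (R 82) (N 24 (R 48) (R 71) (R 71))) W (N 23 (N 23 (R 46) (R 69) (R 69)) W (N
  23 (R 69) W (R 46)))) (N 32 (R 82) (N 50 (R 62) W (R 62)) (R 82)) (N 15 (N 18 (N 25 (R 49) (R
  74) (R 74)) W (N 12 (R 80) W (N 23 (R 69) W (R 46)))) (N 28 (R 81) (R 54) (R 81)) (N 14 (N 13 (R
  82) (R 82) (N 23 (R 70) (R 70) (R 47))) (R 82) (N 15 (N 24 (R 68) W (R 46)) (R 80) (N 53 (R 54)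
  (R 54) W))))) (N 32 (N 25 (N 50 W (R 57) (R 57)) (R 82) (R 82)) (N 25 (R 82) (N 50 (R 57) W W)
  W) W)) (N 32 (N 27 (N 50 W (R 55) (R 55)) (R 82) (R 82)) (N 25 (R 82) (N 50 (R 57) W (R 57)) (R
  82)) (N 25 (R 82) (R 82) (N 50 (R 57) (R 57) W)))) (N 6 (N 5 (N 14 (N 35 (N 47 W (R 63) (R 63))
  (R 82) (R 82)) (N 15 (N 29 (R 53) (R 82) (R 82)) W (N 24 (N 24 (R 48) (R 72) (R 72)) W (N 25 (R
  71) W (R 48)))) (N 14 (N 28 (N 54 W (R 56) (R 56)) (R 82) (R 82)) (N 25 (N 25 (R 48) (R 71) (R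
  71)) W (N 25 (R 71) W (R 48))) (N 28 (R 82) (R 82) (N 54 (R 56) (R 56) W)))) (N 34 (N 24 (N 48 W
  (R 58) (R 58)) (R 82) (R 82)) (N 24 (R 82) (N 48 (R 58) W (R 58)) (R 82)) (N 25 (R 81) (R 81) (N
  48 (R 57) (R 57) W))) (N 19 (N 32 (N 50 W (R 60) (R 60)) (R 82) (R 82)) (N 26 (N 25 (N 50 W (R
  51) (R 51)) (R 76) (R 76)) (N 25 (R 76) (N 50 (R 51) W W) W) W) W)) (N 32 (N 26 (N 50 W (R 56)
  (R 56)) (R 82) (R 82)) (N 25 (R 82) (N 50 (R 57) W (R 57)) (R 82)) (N 25 (R 82) (R 82) (N 50 (R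
  57) (R 57) W))) (N 8 (N 18 (N 31 (N 51 W (R 59) (R 59)) (R 82) (R 82)) (N 25 (N 26 (R 50) (R 74)
  (R 74)) (N 26 (R 74) (R 50) (R 74)) (N 25 (R 75) (R 75) (R 50))) (N 31 (R 82) (R 82) (N 51 (R
  59) (R 59) W))) (N 30 (N 31 (R 51) (R 78) (R 78)) (N 27 (R 80) (N 52 (R 55) W (R 55)) (R 80)) (N
  27 (R 80) (R 80) (N 52 (R 55) (R 55) W))) (N 15 (N 10 (N 28 (N 54 W (R 56) (R 56)) (R 82) (R
  82)) (N 18 (N 26 (R 50) (R 74) (R 74)) (N 12 (R 82) (N 24 (R 70) (R 46) W) W) W) W) (N 13 (N 24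
  (N 23 (R 48) (R 72) (R 71)) (N 24 (R 71) (R 47) (R 71)) (N 23 (R 71) (R 72) (R 48))) (N 15 (N 12
  (R 82) (N 24 (R 70) (R 46) W) W) (N 15 (N 23 (R 69) (R 46) W) (N 53 (R 54) W (R 54)) (R 80)) (R
  82)) (N 28 (R 81) (R 81) (R 54))) (N 33 (R 82) (R 82) (N 49 (R 61) (R 61) W)))))) (N 10 (N 7 (N
  17 (N 31 (N 51 W (R 61) (R 61)) (R 82) (R 82)) (N 20 (N 16 (R 56) (R 82) (N 25 (R 48) (R 72) (R
  72))) (N 16 (R 82) (R 56) (N 25 (R 72) (R 48) (R 72))) (N 12 (N 12 (N 23 (R 46) (R 68) (R 69))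
  (R 80) (R 80)) (N 12 (R 80) (N 23 (R 69) (R 46) W) W) W)) (N 14 (N 28 (R 54) (R 81) (R 81)) (N
  24 (N 23 (R 48) (R 72) (R 72)) (N 23 (R 72) (R 48) (R 72)) (N 25 (R 71) (R 71) (R 47))) (N 28 (R
  81) (R 81) (R 54)))) (N 2 (N 5 (N 11 (N 31 (N 51 W (R 61) (R 61)) (R 82) (R 82)) (N 20 (N 16 (R
  56) (R 82) (N 24 (R 48) (R 72) (R 72))) (N 16 (R 82) (R 56) (N 24 (R 71) (R 48) (R 72))) (N 23
  (N 23 (R 46) (R 69) (R 69)) (N 23 (R 69) (R 46) W) W)) (N 27 (N 25 (N 50 W (R 51) W) (R 76) W)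
  (N 25 (R 76) (N 50 (R 51) W (R 51)) (R 76)) W)) (N 15 (N 16 (N 16 (R 56) (R 82) (N 24 (R 48) (R
  72) W)) (R 82) (N 16 (N 24 (R 48) (R 72) W) (R 82) W)) (N 15 (R 82) (N 15 (R 82) (R 56) (N 24 (R
  73) (N 48 (R 49) W W) W)) (N 15 (R 82) (N 24 (R 73) (N 48 (R 49) W W) W) W)) (N 30 (N 24 (N 48 W
  (R 49) (R 49)) (R 72) (R 73)) (N 24 (R 73) (N 48 (R 49) W W) W) W)) (N 27 (N 27 (N 53 W (R 54)
  (R 54)) (R 80) (R 80)) (N 27 (R 80) (N 53 (R 54) W (R 54)) (R 80)) (N 28 (R 80) (R 80) (R 53))))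
  (N 18 (N 30 (N 52 W (R 60) (R 60)) (R 82) (R 82)) W (N 28 (N 24 (R 50) (R 75) (R 75)) W (N 24 (R
  75) W (R 50)))) (N 2 (N 3 (N 19 (N 29 (N 53 W (R 57) (R 57)) (R 82) (R 82)) (N 29 (R 82) (N 53
  (R 57) W (R 57)) (R 82)) (N 19 (N 25 (N 50 W (R 51) (R 51)) (R 76) (R 76)) (N 12 (R 82) (N 24 (R
  70) (R 47) (R 70)) (R 82)) (N 25 (R 76) (R 76) (N 50 (R 51) (R 51) W)))) (N 18 (N 29 (N 53 W (R
  57) (R 57)) (R 82) (R 82)) (N 29 (R 82) (N 53 (R 57) W (R 57)) (R 82)) (N 25 (N 25 (R 49) (R 73)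
  (R 73)) (N 25 (R 73) (R 49) (R 73)) (N 25 (R 73) (R 73) (R 49)))) (N 27 (N 27 (N 53 W (R 54) (R
  54)) (R 80) (R 80)) (N 27 (R 80) (N 53 (R 54) W (R 54)) (R 80)) (N 28 (R 80) (R 80) (R 53)))) (N
  19 (N 30 (N 52 W (R 58) (R 58)) (R 82) (R 82)) W (N 25 (N 24 (R 50) (R 75) (R 75)) W (N 24 (R
  75) W (R 50)))) (N 28 (N 28 (R 54) (R 80) (R 80)) (N 28 (R 80) (R 54) (R 80)) (N 30 (R 80) (R
  80) (R 52))))) (N 30 (N 26 (N 52 W (R 56) (R 56)) (R 82) (R 82)) (N 29 (R 81) (N 52 (R 53) W (R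
  53)) (R 81)) (N 26 (R 82) (R 82) (N 52 (R 56) (R 56) W)))) (N 7 (N 1 (N 1 (N 18 (N 30 (N 52 W (R
  60) (R 60)) (R 82) (R 82)) (N 30 (R 82) (N 52 (R 60) W (R 60)) (R 82)) (N 27 (N 26 (R 49) (R 73)
  (R 73)) (N 25 (R 75) (R 50) (R 75)) (N 25 (R 75) (R 75) (R 50)))) (N 5 (N 15 (N 15 (N 15 (R 56)
  (R 82) (N 24 (N 48 W (R 49) W) (R 73) W)) (R 82) (N 15 (N 24 (N 48 W (R 49) W) (R 73) W) (R 82)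
  W)) (N 16 (R 82) (N 16 (R 82) (R 56) (N 24 (R 72) (R 48) W)) (N 16 (R 82) (N 24 (R 72) (R 48) W)
  W)) (N 30 (N 24 (N 48 W (R 49) W) (R 73) W) (N 24 (R 72) (N 48 (R 49) W (R 49)) (R 73)) W)) (N
  11 (N 20 (N 16 (R 56) (R 82) (N 24 (R 48) (R 71) (R 72))) (N 16 (R 82) (R 56) (N 24 (R 72) (R
  48) (R 72))) (N 23 (N 23 (R 46) (R 69) W) (N 23 (R 69) (R 46) (R 69)) W)) (N 31 (R 82) (N 51 (R
  61) W (R 61)) (R 82)) (N 27 (N 25 (N 50 W (R 51) (R 51)) (R 76) (R 76)) (N 25 (R 76) (N 50 (R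
  51) W W) W) W)) (N 27 (N 26 (R 54) (R 81) (R 81)) (N 26 (R 81) (R 54) (R 81)) (N 28 (R 80) (R
  80) (R 53)))) (N 6 (N 16 (N 29 (N 53 W (R 58) (R 58)) (R 82) (R 82)) (N 29 (R 82) (N 53 (R 58) W
  (R 58)) (R 82)) (N 26 (N 25 (R 49) (R 73) (R 73)) (N 28 (R 72) (R 48) W) W)) (N 10 (N 20 (N 17
  (N 55 W (R 56) (R 56)) (R 82) (N 25 (R 47) (R 71) (R 71))) (N 16 (R 82) (R 56) (N 24 (R 72) (R
  48) (R 72))) (N 23 (N 23 (R 46) (R 69) (R 69)) (N 23 (R 69) (R 46) W) W)) (N 32 (R 82) (N 50 (R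
  61) W (R 61)) (R 82)) (N 27 (N 25 (N 50 W (R 51) (R 51)) (R 75) (R 76)) (N 25 (R 76) (N 50 (R
  51) W W) W) W)) (N 30 (N 26 (N 52 W (R 53) (R 53)) (R 78) (R 79)) (N 26 (R 78) (N 52 (R 53) W (R
  53)) (R 79)) (N 31 (R 76) (R 76) (R 51))))) (N 5 (N 21 (N 17 (R 59) (R 82) (N 26 (R 50) (R 76)
  (R 76))) W (N 25 (N 24 (N 48 W (R 49) (R 49)) (R 73) (R 73)) W (N 24 (R 73) W (N 48 (R 49) W
  W)))) (N 11 (N 21 (N 16 (R 56) (R 82) (N 24 (R 48) (R 71) (R 72))) (N 16 (R 82) (R 56) (N 24 (R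
  71) (R 48) (R 72))) (N 23 (N 23 (R 46) (R 69) (R 68)) (N 23 (R 69) (R 46) W) W)) (N 31 (R 82) (N
  51 (R 61) W (R 61)) (R 82)) (N 26 (N 26 (R 51) (R 76) (R 76)) (N 26 (R 76) (R 51) (R 76)) (N 26
  (R 76) (R 76) (R 51)))) (N 28 (N 26 (R 54) (R 81) (R 81)) (N 26 (R 81) (R 54) (R 81)) (N 30 (R
  79) (R 79) (R 52)))) (N 2 (N 19 (N 30 (N 52 W (R 59) (R 59)) (R 82) (R 82)) (N 30 (R 82) (N 52
  (R 59) W (R 59)) (R 82)) (N 25 (N 25 (R 50) (R 75) (R 75)) (N 25 (R 75) (R 50) (R 74)) (N 25 (R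
  75) (R 74) (R 50)))) (N 4 (N 17 (N 29 (N 53 W (R 58) (R 58)) (R 82) (R 82)) (N 29 (R 82) (N 53
  (R 58) W (R 58)) (R 82)) (N 26 (N 28 (R 48) (R 72) (R 72)) (N 25 (R 73) (R 49) (R 73)) (N 25 (R
  73) (R 73) (R 49)))) (N 10 (N 21 (N 17 (N 55 W (R 56) (R 56)) (R 82) (N 25 (R 47) (R 71) (R
  71))) W (N 23 (N 23 (R 46) (R 69) (R 69)) W (N 23 (R 69) W (R 46)))) (N 32 (R 82) (N 50 (R 61) W
  (R 61)) (R 82)) (N 26 (N 26 (R 51) (R 76) (R 76)) (N 26 (R 76) (R 51) (R 76)) (N 26 (R 76) (R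
  76) (R 51)))) (N 27 (N 26 (R 54) (R 81) (R 81)) (N 26 (R 81) (R 54) (R 81)) (N 28 (R 80) (R 80)
  (R 53)))) (N 28 (N 27 (N 54 W (R 55) (R 55)) (R 82) (R 82)) (N 27 (R 82) (N 54 (R 55) W (R 55))
  (R 82)) (N 29 (R 81) (R 81) (R 53))))) (N 17 (N 20 (N 16 (R 56) (R 82) (N 25 (R 48) (R 72) (R
  72))) (N 16 (R 82) (R 56) (N 25 (R 72) (R 48) (R 72))) (N 12 (N 12 (N 23 (R 46) (R 68) (R 69))
  (R 80) (R 80)) (N 12 (R 80) (N 23 (R 69) (R 46) W) W) W)) (N 31 (R 82) (N 51 (R 61) W (R 61)) (R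
  82)) (N 14 (N 24 (N 23 (R 48) (R 72) (R 72)) (N 23 (R 72) (R 48) W) W) (N 27 (R 82) (N 54 (R 55)
  W (R 55)) (R 82)) (N 27 (R 82) (R 82) (N 54 (R 55) (R 55) W)))) (N 28 (N 29 (R 53) (R 82) (R
  82)) (N 27 (R 82) (N 54 (R 55) W (R 55)) (R 82)) (N 27 (R 82) (R 82) (N 54 (R 55) (R 55) W))))
  (N 28 (N 28 (R 54) (R 82) (R 82)) (N 27 (R 82) (N 54 (R 55) W (R 55)) (R 82)) (N 27 (R 82) (R
  82) (N 54 (R 55) (R 55) W)))) (N 11 (N 3 (N 16 (N 35 (N 47 W (R 63) W) (R 82) W) (N 15 (N 28 (N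
  54 W (R 55) (R 56)) (R 82) (R 82)) (N 28 (R 82) (N 54 (R 55) W (R 56)) (R 82)) (N 27 (N 24 (N 47
  W (R 48) (R 48)) (R 71) (R 71)) (N 24 (R 71) (N 47 (R 48) W W) W) W)) W) (N 6 (N 15 (N 33 (N 49
  W (R 61) (R 61)) (R 82) (R 82)) (N 10 (N 28 (N 54 W (R 56) (R 56)) (R 82) (R 82)) W (N 19 (N 25
  (R 50) (R 75) (R 75)) W (N 12 (R 81) W (N 25 (R 69) W (R 46))))) (N 13 (N 28 (R 54) (R 81) (R
  81)) (N 24 (N 24 (N 47 W (R 48) (R 48)) (R 71) (R 71)) (N 24 (R 71) (N 47 (R 48) W (R 48)) (R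
  71)) (N 25 (R 71) (R 71) (R 47))) (N 15 (R 82) (N 12 (R 82) W (N 24 (R 70) W (R 46))) (N 15 (R
  80) (N 23 (R 69) W (R 46)) (N 53 (R 54) (R 54) W))))) (N 4 (N 19 (N 29 (N 53 W (R 57) (R 57)) (R
  82) (R 82)) (N 29 (R 82) (N 53 (R 57) W (R 57)) (R 82)) (N 19 (N 25 (N 50 W (R 51) (R 51)) (R
  76) (R 76)) (N 12 (R 82) (N 24 (R 70) (R 47) (R 70)) (R 82)) (N 25 (R 76) (R 76) (N 50 (R 51) (R
  51) W)))) (N 18 (N 29 (N 53 W (R 57) (R 57)) (R 82) (R 82)) (N 29 (R 82) (N 53 (R 57) W (R 57))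
  (R 82)) (N 25 (N 25 (R 49) (R 73) (R 73)) (N 25 (R 73) (R 49) (R 73)) (N 25 (R 73) (R 73) (R
  49)))) (N 29 (N 27 (R 53) (R 79) (R 79)) (N 27 (R 79) (R 53) (R 79)) (N 31 (R 77) (R 77) (R
  51)))) (N 30 (N 27 (N 52 W (R 55) (R 55)) (R 80) (R 80)) (N 30 (R 79) (R 52) (R 79)) (N 27 (R
  80) (R 80) (N 52 (R 55) (R 55) W)))) W) (N 1 (N 7 (N 5 (N 2 (N 17 (N 29 (N 53 W (R 57) (R 57))
  (R 82) (R 82)) (N 29 (R 82) (N 53 (R 57) W (R 57)) (R 82)) (N 19 (N 27 (R 50) (R 75) (R 75)) (N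
  12 (R 82) (N 24 (R 70) (R 47) (R 70)) (R 82)) (N 27 (R 75) (R 75) (R 50)))) (N 18 (N 28 (N 54 W
  (R 56) (R 56)) (R 82) (R 82)) (N 28 (R 82) (N 54 (R 56) W (R 56)) (R 82)) (N 25 (N 24 (N 48 W (R
  49) (R 49)) (R 73) (R 73)) (N 26 (R 72) (R 48) (R 72)) (N 24 (R 73) (R 73) (N 48 (R 49) (R 49)
  W)))) (N 4 (N 17 (N 28 (R 54) (R 82) (R 82)) (N 28 (R 82) (R 54) (R 82)) (N 18 (N 24 (R 50) (R
  75) (R 75)) (N 12 (R 81) (N 24 (R 69) (R 46) (R 69)) (R 81)) (N 24 (R 75) (R 75) (R 50)))) (N 17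
  (N 28 (R 54) (R 82) (R 82)) (N 28 (R 82) (R 54) (R 82)) (N 24 (N 24 (R 48) (R 72) (R 72)) (N 24
  (R 72) (R 48) (R 71)) (N 24 (R 72) (R 71) (R 48)))) (N 27 (N 26 (R 52) (R 78) (R 78)) (N 26 (R
  78) (R 52) (R 78)) (N 28 (R 77) (R 77) (R 51))))) (N 19 (N 29 (N 53 W (R 57) (R 57)) (R 82) (R
  82)) (N 29 (R 82) (N 53 (R 57) W (R 57)) (R 82)) (N 19 (N 12 (N 24 (R 47) (R 70) (R 70)) (R 82)
  (R 82)) (N 25 (R 76) (N 50 (R 51) W (R 51)) (R 75)) (N 25 (R 76) (R 75) (N 50 (R 51) (R 51)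
  W)))) (N 30 (N 27 (N 52 W (R 53) (R 53)) (R 79) (R 79)) (N 27 (R 79) (N 52 (R 53) W (R 53)) (R
  79)) (N 31 (R 76) (R 76) (R 51)))) (N 16 (N 10 (N 28 (N 54 W (R 56) (R 56)) (R 82) (R 82)) W (N
  19 (N 25 (R 50) (R 74) (R 75)) W (N 13 (R 81) W (N 24 (R 69) W (R 46))))) (N 33 (R 82) (N 49 (R
  60) W (R 61)) (R 82)) (N 15 (N 24 (N 24 (R 47) (R 69) (R 70)) (N 24 (R 69) (R 47) (R 70)) (N 24
  (R 70) (R 70) (R 47))) (N 27 (R 81) (R 54) (R 81)) (N 27 (R 81) (R 81) (R 54)))) (N 30 (N 30 (R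
  52) (R 80) (R 80)) (N 26 (R 82) (N 52 (R 56) W (R 56)) (R 82)) (N 26 (R 82) (R 82) (N 52 (R 56)
  (R 56) W)))) (N 2 (N 6 (N 4 (N 18 (N 29 (N 53 W (R 57) (R 57)) (R 82) (R 82)) (N 29 (R 82) (N 53
  (R 57) W (R 57)) (R 82)) (N 25 (N 25 (R 49) (R 73) (R 73)) (N 25 (R 73) (R 49) (R 73)) (N 25 (R
  73) (R 73) (R 49)))) (N 19 (N 29 (N 53 W (R 57) (R 57)) (R 82) (R 82)) (N 29 (R 82) (N 53 (R 57)
  W (R 57)) (R 82)) (N 19 (N 12 (N 24 (R 47) (R 70) (R 70)) (R 82) (R 82)) (N 25 (R 76) (N 50 (R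
  51) W (R 51)) (R 76)) (N 25 (R 76) (R 76) (N 50 (R 51) (R 51) W)))) (N 29 (N 27 (R 53) (R 79) (R
  79)) (N 27 (R 79) (R 53) (R 79)) (N 31 (R 77) (R 77) (R 51)))) (N 15 (N 10 (N 28 (N 54 W (R 56)
  (R 56)) (R 82) (R 82)) W (N 19 (N 25 (R 50) (R 75) (R 75)) W (N 13 (R 81) W (N 24 (R 69) W (R
  46))))) (N 33 (R 82) (N 49 (R 61) W (R 61)) (R 82)) (N 13 (N 24 (N 24 (N 47 W (R 48) (R 48)) (R
  71) (R 71)) (N 24 (R 71) (N 47 (R 48) W (R 48)) (R 71)) (N 25 (R 71) (R 71) (R 47))) (N 28 (R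
  81) (R 54) (R 81)) (N 15 (N 12 (R 82) W (N 24 (R 70) W (R 46))) (R 82) (N 15 (N 23 (R 69) W (R
  46)) (R 80) (N 53 (R 54) (R 54) W))))) (N 30 (N 30 (R 52) (R 79) (R 79)) (N 27 (R 81) (N 52 (R
  55) W (R 55)) (R 81)) (N 27 (R 81) (R 81) (N 52 (R 55) (R 55) W)))) (N 15 (N 14 (N 29 (N 53 W (R
  56) (R 57)) (R 82) (R 82)) (N 29 (R 82) (N 53 (R 56) W (R 57)) (R 82)) (N 25 (N 25 (N 46 W (R
  50) W) (R 71) W) (N 25 (R 71) (N 46 (R 49) W (R 50)) (R 71)) W)) (N 36 (R 82) (N 46 (R 64) W (R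
  64)) (R 82)) (N 14 (N 25 (N 25 (N 46 W (R 50) (R 49)) (R 71) (R 71)) (N 27 (R 71) (N 46 (R 49) W
  W) W) W) (N 27 (R 82) (R 55) (R 82)) (N 27 (R 82) (R 82) (R 55)))) (N 28 (N 28 (R 54) (R 82) (R
  82)) (N 27 (R 82) (N 54 (R 55) W (R 55)) (R 82)) (N 27 (R 82) (R 82) (N 54 (R 55) (R 55) W))))
  (N 28 (N 27 (N 54 W (R 55) (R 55)) (R 82) (R 82)) (N 27 (R 82) (N 54 (R 55) W W) W) W)) W)) W (N
  10 (N 1 (N 3 (N 15 (N 36 (N 46 W (R 65) (R 65)) (R 82) (R 82)) (N 14 (N 29 (N 53 W (R 57) (R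
  58)) (R 82) (R 82)) (N 29 (R 82) (N 53 (R 57) W (R 58)) (R 82)) (N 26 (N 25 (N 47 W (R 50) (R
  50)) (R 72) (R 72)) (N 25 (R 72) (N 47 (R 50) W (R 50)) (R 72)) (N 24 (R 72) (R 72) (R 48)))) (N
  18 (N 28 (N 54 W (R 56) (R 55)) (R 82) (R 82)) (N 25 (N 24 (R 48) (R 72) (R 72)) (N 24 (R 72) (R
  48) W) W) W)) (N 7 (N 16 (N 32 (N 50 W (R 61) (R 61)) (R 82) (R 82)) (N 20 (N 16 (R 56) (R 82)
  (N 24 (R 48) (R 72) (R 72))) (N 17 (R 82) (N 55 (R 56) W (R 56)) (N 25 (R 71) (R 47) (R 71))) (N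
  23 (N 23 (R 46) (R 69) W) (N 23 (R 69) (R 46) (R 68)) W)) (N 13 (N 28 (R 54) (R 81) (R 81)) (N
  24 (N 23 (R 48) (R 71) (R 72)) (N 23 (R 71) (R 48) (R 72)) (N 25 (R 71) (R 71) (R 47))) (N 15 (R
  82) (N 12 (R 82) W (N 24 (R 70) W (R 46))) (N 15 (R 80) (N 23 (R 69) W (R 46)) (N 53 (R 54) (R
  54) W))))) (N 20 (N 30 (N 52 W (R 59) (R 59)) (R 82) (R 82)) (N 30 (R 82) (N 52 (R 59) W (R 59))
  (R 82)) (N 25 (N 25 (R 50) (R 75) (R 75)) (N 25 (R 75) (R 50) (R 75)) (N 25 (R 75) (R 75) (R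
  50)))) (N 31 (N 26 (N 51 W (R 56) (R 56)) (R 81) (R 81)) (N 29 (R 80) (N 51 (R 53) W (R 53)) (R
  80)) (N 26 (R 81) (R 81) (N 51 (R 56) (R 56) W)))) (N 7 (N 16 (N 33 (N 49 W (R 61) (R 61)) (R
  82) (R 82)) (N 15 (N 27 (R 54) (R 81) (R 81)) (N 27 (R 81) (R 54) (R 81)) (N 24 (N 24 (R 47) (R
  70) (R 70)) (N 24 (R 70) (R 47) (R 70)) (N 24 (R 70) (R 70) (R 47)))) (N 20 (N 16 (R 56) (N 24
  (R 48) (R 72) (R 72)) (R 82)) (N 23 (N 23 (R 46) (R 69) (R 69)) (N 23 (R 69) (R 46) W) W) W)) (N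
  30 (N 26 (N 52 W (R 56) (R 56)) (R 82) (R 82)) (N 26 (R 82) (N 52 (R 56) W (R 56)) (R 82)) (N 30
  (R 80) (R 80) (R 52))) (N 5 (N 19 (N 29 (N 53 W (R 57) (R 57)) (R 82) (R 82)) (N 19 (N 25 (N 50
  W (R 51) (R 51)) (R 76) (R 76)) (N 25 (R 76) (N 50 (R 51) W (R 51)) (R 76)) (N 12 (R 82) (R 82)
  (N 24 (R 70) (R 70) (R 47)))) (N 29 (R 82) (R 82) (N 53 (R 57) (R 57) W))) (N 30 (N 27 (N 52 W
  (R 53) (R 53)) (R 78) (R 78)) (N 31 (R 77) (R 51) (R 77)) (N 27 (R 78) (R 78) (N 52 (R 53) (R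
  53) W))) (N 2 (N 18 (N 28 (N 54 W (R 56) (R 56)) (R 82) (R 82)) (N 25 (N 26 (R 48) (R 72) (R
  72)) (N 24 (R 73) (N 48 (R 49) W (R 49)) (R 73)) (N 24 (R 73) (R 73) (N 48 (R 49) (R 49) W))) (N
  28 (R 82) (R 82) (N 54 (R 56) (R 56) W))) (N 4 (N 17 (N 28 (R 54) (R 82) (R 82)) (N 24 (N 24 (R
  48) (R 72) (R 72)) (N 24 (R 72) (R 48) (R 72)) (N 24 (R 72) (R 72) (R 48))) (N 28 (R 82) (R 82)
  (R 54))) (N 27 (N 26 (R 52) (R 78) (R 78)) (N 28 (R 77) (R 51) (R 77)) (N 26 (R 78) (R 78) (R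
  52))) (N 17 (N 28 (R 54) (R 82) (R 82)) (N 18 (N 12 (N 24 (R 46) (R 69) (R 69)) (R 81) (R 81))
  (N 24 (R 75) (R 50) (R 74)) (N 24 (R 75) (R 74) (R 50))) (N 28 (R 82) (R 82) (R 54)))) (N 17 (N
  29 (N 53 W (R 57) (R 57)) (R 82) (R 82)) (N 19 (N 12 (N 24 (R 47) (R 70) (R 70)) (R 82) (R 82))
  (N 27 (R 75) (R 50) (R 75)) (N 27 (R 75) (R 75) (R 50))) (N 29 (R 82) (R 82) (N 53 (R 57) (R 57)
  W))))))) (N 8 (N 17 (N 32 (N 50 W (R 61) (R 61)) (R 82) (R 82)) (N 20 (N 17 (N 55 W (R 56) (R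
  56)) (R 82) (N 24 (R 48) (R 72) (R 72))) W (N 12 (N 12 (N 23 (R 46) (R 69) (R 69)) (R 80) (R
  80)) W (N 12 (R 80) W (N 23 (R 69) W (R 46))))) (N 14 (N 27 (N 54 W (R 55) (R 55)) (R 82) (R
  82)) (N 24 (N 23 (R 48) (R 72) (R 72)) (N 25 (R 71) (R 47) (R 71)) (N 23 (R 72) (R 72) (R 48)))
  (N 27 (R 82) (R 82) (N 54 (R 55) (R 55) W)))) (N 4 (N 5 (N 10 (N 31 (N 51 W (R 60) (R 60)) (R
  82) (R 82)) (N 20 (N 16 (N 55 W (R 56) (R 56)) (R 82) (N 23 (R 48) (R 72) (R 72))) W (N 23 (N 22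
  (R 46) (R 69) W) W W)) (N 26 (N 25 (N 50 W (R 51) W) (R 76) W) (N 25 (R 75) (N 50 (R 51) W (R
  51)) (R 76)) W)) (N 21 (N 17 (R 58) (R 82) (N 25 (R 50) (R 75) (R 75))) W (N 24 (N 24 (R 48) (R
  72) (R 72)) W (N 24 (R 72) W (R 48)))) (N 27 (N 27 (R 53) (R 78) (R 79)) (N 27 (R 78) (R 53) (R
  79)) (N 28 (R 79) (R 79) (R 52)))) (N 2 (N 18 (N 29 (N 53 W (R 58) (R 58)) (R 82) (R 82)) (N 29
  (R 82) (N 53 (R 58) W (R 58)) (R 82)) (N 26 (N 25 (R 49) (R 72) (R 72)) (N 25 (R 73) (R 49) (R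
  72)) (N 25 (R 73) (R 72) (R 49)))) (N 18 (N 29 (N 53 W (R 58) (R 58)) (R 82) (R 82)) (N 29 (R
  82) (N 53 (R 58) W (R 58)) (R 82)) (N 18 (N 13 (N 23 (R 48) (R 72) (R 72)) (R 82) (R 82)) (N 26
  (R 77) (R 51) (R 77)) (N 28 (R 76) (R 76) (R 50)))) (N 4 (N 17 (N 27 (R 55) (R 82) (R 82)) (N 27
  (R 82) (R 55) (R 82)) (N 25 (N 24 (N 48 W (R 49) (R 49)) (R 73) (R 72)) (N 26 (R 72) (R 48) (R
  72)) (N 24 (R 72) (R 73) (N 48 (R 49) (R 49) W)))) (N 18 (N 27 (R 55) (R 82) (R 82)) (N 27 (R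
  82) (R 55) (R 82)) (N 19 (N 12 (N 23 (N 46 W (R 47) (R 47)) (R 70) (R 70)) (R 81) (R 81)) (N 25
  (R 75) (R 50) (R 75)) (N 25 (R 75) (R 75) (R 50)))) (N 28 (N 26 (N 52 W (R 53) (R 53)) (R 79) (R
  79)) (N 26 (R 79) (N 52 (R 53) W (R 53)) (R 79)) (N 30 (R 77) (R 77) (R 51))))) (N 30 (N 26 (N
  52 W (R 55) (R 55)) (R 81) (R 81)) (N 26 (R 81) (N 52 (R 55) W (R 55)) (R 81)) (N 31 (R 78) (R
  78) (R 51)))) (N 28 (N 27 (N 54 W (R 55) (R 55)) (R 82) (R 82)) (N 30 (R 82) (R 52) (R 82)) (N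
  27 (R 82) (R 82) (N 54 (R 55) (R 55) W)))) (N 3 (N 15 (N 37 (N 45 W (R 65) W) (R 82) W) (N 15 (N
  29 (N 53 W (R 57) (R 57)) (R 82) (R 82)) (N 29 (R 82) (N 53 (R 57) W (R 57)) (R 82)) (N 25 (N 24
  (R 48) (R 72) W) (N 25 (R 72) (N 47 (R 50) W (R 50)) (R 72)) W)) W) (N 8 (N 15 (N 33 (N 49 W (R
  60) (R 61)) (R 82) (R 82)) (N 20 (N 16 (R 56) (R 82) (N 24 (R 48) (R 72) (R 72))) W (N 23 (N 23
  (R 46) (R 69) (R 69)) W (N 23 (R 69) W (R 46)))) (N 13 (N 28 (R 54) (R 81) (R 81)) (N 24 (N 23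
  (R 48) (R 71) (R 72)) (N 23 (R 71) (R 48) (R 72)) (N 25 (R 71) (R 71) (R 47))) (N 15 (R 82) (N
  12 (R 82) W (N 24 (R 70) W (R 46))) (N 15 (R 80) (N 23 (R 69) W (R 46)) (N 53 (R 54) (R 54)
  W))))) (N 7 (N 18 (N 28 (N 54 W (R 56) (R 56)) (R 82) (R 82)) (N 28 (R 82) (N 54 (R 56) W (R
  56)) (R 82)) (N 19 (N 25 (R 50) (R 75) (R 75)) (N 12 (R 81) (N 23 (R 70) (N 46 (R 47) W (R 47))
  (R 70)) (R 81)) (N 25 (R 75) (R 75) (R 50)))) (N 18 (N 28 (N 54 W (R 56) (R 56)) (R 82) (R 82))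
  (N 28 (R 82) (N 54 (R 56) W (R 56)) (R 82)) (N 19 (N 13 (N 24 (R 46) (R 68) W) (R 81) W) (N 25
  (R 75) (R 50) (R 75)) W)) (N 31 (N 26 (N 51 W (R 52) (R 52)) (R 77) (R 77)) (N 26 (R 77) (N 51
  (R 52) W (R 52)) (R 77)) (N 31 (R 75) (R 75) (R 50)))) (N 30 (N 27 (N 52 W (R 55) (R 55)) (R 81)
  (R 81)) (N 31 (R 78) (R 51) (R 78)) (N 27 (R 81) (R 81) (N 52 (R 55) (R 55) W)))) W)) W (N 9 (N
  4 (N 3 (N 19 (N 29 (N 53 W (R 57) (R 57)) (R 82) (R 82)) (N 19 (N 25 (N 50 W (R 51) (R 51)) (R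
  76) (R 76)) (N 25 (R 76) (N 50 (R 51) W (R 51)) (R 76)) (N 12 (R 82) (R 82) (N 24 (R 70) (R 70)
  (R 47)))) (N 29 (R 82) (R 82) (N 53 (R 57) (R 57) W))) (N 27 (N 27 (N 53 W (R 54) (R 54)) (R 80)
  (R 80)) (N 28 (R 80) (R 53) (R 80)) (N 27 (R 80) (R 80) (N 53 (R 54) (R 54) W))) (N 17 (N 30 (N
  52 W (R 58) (R 58)) (R 82) (R 82)) (N 25 (N 25 (N 48 W (R 50) (R 50)) (R 73) (R 73)) (N 25 (R
  73) (N 48 (R 50) W (R 50)) (R 73)) (N 24 (R 73) (R 73) (R 49))) (N 30 (R 82) (R 82) (N 52 (R 58)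
  (R 58) W)))) (N 31 (N 26 (N 51 W (R 55) (R 55)) (R 80) (R 80)) (N 31 (R 77) (R 51) W) W) W) W (N
  14 (N 14 (N 28 (N 54 W (R 56) (R 56)) (R 82) (R 82)) (N 25 (N 24 (R 48) (R 72) (R 72)) W (N 24
  (R 72) W (R 48))) (N 28 (R 82) (R 82) (N 54 (R 56) (R 56) W))) W (N 35 (R 82) W (N 47 (R 63) W
  W)))))) W) W W

/-- The Adversary has a winning strategy in the Online Bin Stretching game
`Game(3, 112, 82)` from the empty item list and all-zero bin loads; hence no
online bin stretching algorithm on 3 bins has stretching factor smaller than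
`112/82 ≈ 1.3658`. -/
theorem lowerBoundBS_112_82 :
    AdvWins 3 112 82 [] (List.replicate 3 0) :=
  strategy.advWins_of_wins (t := 111) (by decide +kernel)
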